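/- arXiv:2508.19413 — 4 statements merged into one kernel-verified Lean document; each statement's English description precedes it below -/
import Mathlib

section
/- For every n ≥ 4 there exist convex sets K₁, …, Kₙ ⊆ ℝ² such that the set S = ℝ² \ (K₁ ∪ … ∪ Kₙ) has exactly t(n, 4) distinct 1-ordinary flats (ordinary lines), where t(n, 4) is the Turán number. -/
open Metric Set Module

/-- `HasSimplex S k` : the set `S` contains a `k`-simplex, i.e. the convex hull
of `k+1` affinely independent points. -/
def HasSimplex {d : ℕ} (S : Set (EuclideanSpace ℝ (Fin d))) (k : ℕ) : Prop :=
  ∃ f : Fin (k + 1) → EuclideanSpace ℝ (Fin d),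
    AffineIndependent ℝ f ∧ convexHull ℝ (Set.range f) ⊆ S

/-- The flat-dimension `dm S` of a set `S ⊆ ℝ^d`: the maximal `k` such that `S`
contains a `k`-simplex. -/
noncomputable def dm {d : ℕ} (S : Set (EuclideanSpace ℝ (Fin d))) : ℕ :=
  sSup {k : ℕ | HasSimplex S k}

/-- The local dimension `dmLoc S p` of `S` at `p`: the minimum over `ε > 0` of
the flat-dimension of `S ∩ B(p, ε)`. -/
noncomputable def dmLoc {d : ℕ} (S : Set (EuclideanSpace ℝ (Fin d)))
    (p : EuclideanSpace ℝ (Fin d)) : ℕ :=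
  sInf {m : ℕ | ∃ ε > 0, m = dm (S ∩ ball p ε)}

/-- `p` is a `k`-ordinary point of `S`: its local dimension is `k` and, near `p`,
`S` coincides with a `k`-flat. -/
def IsOrdinaryPoint {d : ℕ} (S : Set (EuclideanSpace ℝ (Fin d))) (k : ℕ)
    (p : EuclideanSpace ℝ (Fin d)) : Prop :=
  p ∈ S ∧ dmLoc S p = k ∧
    ∃ H : AffineSubspace ℝ (EuclideanSpace ℝ (Fin d)),
      finrank ℝ H.direction = k ∧
      ∃ U, IsOpen U ∧ p ∈ U ∧ S ∩ U = (H : Set (EuclideanSpace ℝ (Fin d))) ∩ U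

/-- `H` is a `k`-ordinary flat of `S`: `H` is a `k`-flat which witnesses some
`k`-ordinary point of `S`. -/
def IsOrdinaryFlat {d : ℕ} (S : Set (EuclideanSpace ℝ (Fin d))) (k : ℕ)
    (H : AffineSubspace ℝ (EuclideanSpace ℝ (Fin d))) : Prop :=
  finrank ℝ H.direction = k ∧
    ∃ p ∈ S, dmLoc S p = k ∧
      ∃ U, IsOpen U ∧ p ∈ U ∧ S ∩ U = (H : Set (EuclideanSpace ℝ (Fin d))) ∩ U

/-- The Turán number `t(n, 4)`: the maximum number of edges of a simple graph on
`n` vertices containing no complete subgraph on `5` vertices. -/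
noncomputable def turanNumber4 (n : ℕ) : ℕ :=
  sSup {m : ℕ | ∃ G : SimpleGraph (Fin n), G.CliqueFree 5 ∧ m = G.edgeSet.ncard}

section OrdinaryLines

open Filter
open scoped RealInnerProductSpace Topology

/-! ### The Turán number -/

theorem turanNumber4_eq (n : ℕ) :
    turanNumber4 n = (SimpleGraph.turanGraph n 4).edgeSet.ncard := by
  obtain ⟨hfree, hmax⟩ := SimpleGraph.isTuranMaximal_turanGraph (n := n) (r := 4) (by norm_num)
  refine IsGreatest.csSup_eq ⟨⟨_, hfree, rfl⟩, ?_⟩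
  rintro _ ⟨G, hG, rfl⟩
  classical
  simpa [← SimpleGraph.coe_edgeFinset, Set.ncard_coe_finset] using hmax hG

/-! ### Local dimension along a line -/

theorem HasSimplex.le_finrank {d k : ℕ} {S : Set (EuclideanSpace ℝ (Fin d))}
    {H : AffineSubspace ℝ (EuclideanSpace ℝ (Fin d))} (h : HasSimplex S k)
    (hS : S ⊆ (H : Set (EuclideanSpace ℝ (Fin d)))) : k ≤ finrank ℝ H.direction := by
  obtain ⟨f, hf, hfS⟩ := h
  rw [← hf.finrank_vectorSpan (Fintype.card_fin _), ← direction_affineSpan]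
  refine Submodule.finrank_mono (AffineSubspace.direction_le (affineSpan_le.2 ?_))
  exact (subset_convexHull ℝ _).trans (hfS.trans hS)

theorem HasSimplex.le_dm {d k : ℕ} {S : Set (EuclideanSpace ℝ (Fin d))} (h : HasSimplex S k) :
    k ≤ dm S :=
  le_csSup ⟨_, fun _ hk => hk.le_finrank (H := ⊤) (by simp)⟩ h

theorem dmLoc_eq_one {d : ℕ} {S U : Set (EuclideanSpace ℝ (Fin d))}
    {H : AffineSubspace ℝ (EuclideanSpace ℝ (Fin d))} {p : EuclideanSpace ℝ (Fin d)}
    (hH : finrank ℝ H.direction = 1) (hU : IsOpen U) (hpU : p ∈ U) (hpS : p ∈ S)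
    (hSU : S ∩ U = (H : Set (EuclideanSpace ℝ (Fin d))) ∩ U) : dmLoc S p = 1 := by
  obtain ⟨δ, hδ, hball⟩ := Metric.isOpen_iff.1 hU p hpU
  have hpH : p ∈ H := (hSU.subset ⟨hpS, hpU⟩).1
  obtain ⟨⟨v, hv⟩, hv0, -⟩ := finrank_eq_one_iff'.1 hH
  replace hv0 : v ≠ 0 := fun h => hv0 (by simpa using h)
  have hsimplex : ∀ ε > 0, HasSimplex (S ∩ ball p ε) 1 := by
    intro ε hε
    have hmem : ∀ᶠ t in 𝓝[>] (0 : ℝ), p + t • v ∈ ball p ε ∩ ball p δ := by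
      refine (ContinuousAt.eventually_mem (f := fun t : ℝ => p + t • v) (by fun_prop) ?_).filter_mono
        nhdsWithin_le_nhds
      simpa using inter_mem (ball_mem_nhds p hε) (ball_mem_nhds p hδ)
    obtain ⟨t, ht, ht0⟩ := (hmem.and self_mem_nhdsWithin).exists
    refine ⟨![p, p + t • v], affineIndependent_of_ne ℝ ?_, ?_⟩
    · simpa using ⟨(ne_of_gt ht0 : t ≠ 0), hv0⟩
    have hsub : convexHull ℝ (Set.range ![p, p + t • v]) ⊆
        (ball p ε ∩ ball p δ) ∩ (H : Set (EuclideanSpace ℝ (Fin d))) := by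
      refine convexHull_min ?_ (((convex_ball _ _).inter (convex_ball _ _)).inter H.convex)
      rintro _ ⟨i, rfl⟩
      fin_cases i
      · exact ⟨⟨mem_ball_self hε, mem_ball_self hδ⟩, hpH⟩
      · refine ⟨ht, ?_⟩
        have := AffineSubspace.vadd_mem_of_mem_direction (H.direction.smul_mem t hv) hpH
        simpa [add_comm] using this
    intro x hx
    obtain ⟨⟨hxε, hxδ⟩, hxH⟩ := hsub hx
    exact ⟨(hSU.superset ⟨hxH, hball hxδ⟩).1, hxε⟩
  refine IsLeast.csInf_eq ⟨⟨δ, hδ, le_antisymm (hsimplex δ hδ).le_dm ?_⟩, ?_⟩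
  · refine csSup_le ⟨1, hsimplex δ hδ⟩ fun k hk => hH ▸ hk.le_finrank ?_
    exact fun x hx => (hSU.subset ⟨hx.1, hball hx.2⟩).1
  · rintro _ ⟨ε, hε, rfl⟩
    exact (hsimplex ε hε).le_dm

/-! ### Lines in the plane through normal vectors -/

/-- The line (for `ν ≠ 0`) through `p` with normal vector `ν`. -/
noncomputable def normalLine (ν p : EuclideanSpace ℝ (Fin 2)) :
    AffineSubspace ℝ (EuclideanSpace ℝ (Fin 2)) :=
  AffineSubspace.mk' p (ℝ ∙ ν)ᗮ

theorem mem_normalLine {ν p x : EuclideanSpace ℝ (Fin 2)} :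
    x ∈ normalLine ν p ↔ ⟪ν, x - p⟫ = 0 := by
  rw [normalLine, AffineSubspace.mem_mk', Submodule.mem_orthogonal_singleton_iff_inner_right,
    vsub_eq_sub]

theorem normalLine_neg (ν p : EuclideanSpace ℝ (Fin 2)) : normalLine (-ν) p = normalLine ν p := by
  ext x
  simp [mem_normalLine, inner_neg_left]

theorem finrank_direction_normalLine {ν : EuclideanSpace ℝ (Fin 2)} (hν : ν ≠ 0)
    (p : EuclideanSpace ℝ (Fin 2)) : finrank ℝ (normalLine ν p).direction = 1 := by
  have : Fact (finrank ℝ (EuclideanSpace ℝ (Fin 2)) = 1 + 1) := ⟨by simp⟩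
  rw [normalLine, AffineSubspace.direction_mk']
  exact Submodule.finrank_orthogonal_span_singleton hν

theorem exists_eq_normalLine {H : AffineSubspace ℝ (EuclideanSpace ℝ (Fin 2))}
    {p : EuclideanSpace ℝ (Fin 2)} (hH : finrank ℝ H.direction = 1) (hp : p ∈ H) :
    ∃ ν ≠ 0, H = normalLine ν p := by
  have hperp : finrank ℝ H.directionᗮ = 1 := by
    have := H.direction.finrank_add_finrank_orthogonal
    simp [hH] at this
    omega
  obtain ⟨⟨ν, hν⟩, hν0, hspan⟩ := finrank_eq_one_iff'.1 hperp
  have h0 : ν ≠ 0 := fun h => hν0 (by simpa using h)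
  refine ⟨ν, h0, AffineSubspace.eq_of_direction_eq_of_nonempty_of_le ?_ ⟨p, hp⟩ fun x hx => ?_⟩
  · refine Submodule.eq_of_le_of_finrank_eq (fun x hx => ?_) ?_
    · rw [normalLine, AffineSubspace.direction_mk',
        Submodule.mem_orthogonal_singleton_iff_inner_right]
      exact Submodule.inner_left_of_mem_orthogonal hx hν
    · rw [hH, finrank_direction_normalLine h0]
  · exact mem_normalLine.2 (Submodule.inner_left_of_mem_orthogonal
      (AffineSubspace.vsub_mem_direction hx hp) hν)

/-- If a line is locally the complement of finitely many convex sets, then it supports one of them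
on the side of a given normal vector. -/
theorem exists_supported_of_inter_eq {ι : Type*} [Finite ι]
    {K : ι → Set (EuclideanSpace ℝ (Fin 2))} (hK : ∀ i, Convex ℝ (K i))
    {ν q : EuclideanSpace ℝ (Fin 2)} (hν : ν ≠ 0) {U : Set (EuclideanSpace ℝ (Fin 2))}
    (hU : IsOpen U) (hq : q ∈ U)
    (hKU : (⋃ i, K i)ᶜ ∩ U = (normalLine ν q : Set (EuclideanSpace ℝ (Fin 2))) ∩ U) :
    ∃ i, ∀ x ∈ K i, 0 ≤ ⟪ν, x - q⟫ := by
  have hνν : 0 < ⟪ν, ν⟫ := real_inner_self_pos.2 hν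
  have hU0 : ∀ᶠ t in 𝓝[>] (0 : ℝ), q + t • ν ∈ U :=
    (ContinuousAt.eventually_mem (f := fun t : ℝ => q + t • ν) (by fun_prop)
      (by simpa using hU.mem_nhds hq)).filter_mono nhdsWithin_le_nhds
  have hcover : ∀ᶠ t in 𝓝[>] (0 : ℝ), ∃ i, q + t • ν ∈ K i := by
    filter_upwards [hU0, self_mem_nhdsWithin] with t ht ht0
    by_contra hcon
    have hmem := (hKU.subset ⟨by simpa using hcon, ht⟩).1
    rw [SetLike.mem_coe, mem_normalLine, add_sub_cancel_left, inner_smul_right] at hmem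
    exact (mul_pos ht0 hνν).ne' hmem
  have hfreq : ∃ i, ∃ᶠ t in 𝓝[>] (0 : ℝ), q + t • ν ∈ K i := by
    by_contra! hcon
    obtain ⟨t, ⟨i, hi⟩, ht⟩ := (hcover.and (eventually_all.2 hcon)).exists
    exact ht i hi
  obtain ⟨i, hi⟩ := hfreq
  refine ⟨i, fun x hx => ?_⟩
  by_contra! hneg
  set a := ⟪ν, x - q⟫ with ha
  let s : ℝ → ℝ := fun t => t * ⟪ν, ν⟫ / (t * ⟪ν, ν⟫ - a)
  have hr : ∀ᶠ t in 𝓝[>] (0 : ℝ), (1 - s t) • (q + t • ν) + s t • x ∈ U := by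
    have hs : ContinuousAt s 0 := by
      refine ContinuousAt.div (by fun_prop) (by fun_prop) ?_
      simpa using hneg.ne
    refine (ContinuousAt.eventually_mem
      (f := fun t : ℝ => (1 - s t) • (q + t • ν) + s t • x) (by fun_prop) ?_).filter_mono
      nhdsWithin_le_nhds
    simpa [s] using hU.mem_nhds hq
  obtain ⟨t, hti, htU, ht0⟩ := (hi.and_eventually (hr.and self_mem_nhdsWithin)).exists
  have ht : 0 < t * ⟪ν, ν⟫ := mul_pos ht0 hνν
  have hden : 0 < t * ⟪ν, ν⟫ - a := by linarith
  have hs0 : 0 ≤ s t := (div_pos ht hden).le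
  have hs1 : 0 ≤ 1 - s t := by
    rw [sub_nonneg]
    exact (div_le_one hden).2 (by linarith)
  have hmem : (1 - s t) • (q + t • ν) + s t • x ∈ normalLine ν q := by
    rw [mem_normalLine]
    have : (1 - s t) • (q + t • ν) + s t • x - q = (1 - s t) • (t • ν) + s t • (x - q) := by
      module
    rw [this, inner_add_right, inner_smul_right, inner_smul_right, inner_smul_right, ← ha]
    simp only [s]
    field_simp
    ring
  refine (hKU.superset ⟨hmem, htU⟩).1 (mem_iUnion.2 ⟨i, ?_⟩)
  exact hK i hti hx hs1 hs0 (by ring)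

/-- Half-planes touching at a point determine their separating line. -/
theorem normalLine_eq_of_supported {ν μ p q : EuclideanSpace ℝ (Fin 2)} (hν : ν ≠ 0) (hμ : μ ≠ 0)
    {A B : Set (EuclideanSpace ℝ (Fin 2))}
    (hA : ∀ᶠ x in 𝓝 p, 0 < ⟪ν, x - p⟫ → x ∈ A) (hB : ∀ᶠ x in 𝓝 p, ⟪ν, x - p⟫ < 0 → x ∈ B)
    (hAμ : ∀ x ∈ A, 0 ≤ ⟪μ, x - q⟫) (hBμ : ∀ x ∈ B, ⟪μ, x - q⟫ ≤ 0) :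
    normalLine ν p = normalLine μ q := by
  have hνν : 0 < ⟪ν, ν⟫ := real_inner_self_pos.2 hν
  have key : ∀ v, 0 < ⟪ν, v⟫ → ∀ᶠ t in 𝓝[>] (0 : ℝ),
      0 ≤ ⟪μ, p - q⟫ + t * ⟪μ, v⟫ ∧ ⟪μ, p - q⟫ - t * ⟪μ, v⟫ ≤ 0 := by
    intro v hv
    have h1 : Tendsto (fun t : ℝ => p + t • v) (𝓝[>] 0) (𝓝 p) :=
      (Continuous.tendsto' (by fun_prop) _ _ (by simp)).mono_left nhdsWithin_le_nhds
    have h2 : Tendsto (fun t : ℝ => p - t • v) (𝓝[>] 0) (𝓝 p) :=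
      (Continuous.tendsto' (by fun_prop) _ _ (by simp)).mono_left nhdsWithin_le_nhds
    filter_upwards [h1.eventually hA, h2.eventually hB, self_mem_nhdsWithin] with t hA' hB' ht
    have ht : 0 < t := ht
    constructor
    · have := hAμ _ (hA' (by simpa [inner_smul_right] using mul_pos ht hv))
      rwa [add_sub_right_comm, inner_add_right, inner_smul_right] at this
    · have := hBμ _ (hB' (by
        rw [sub_sub_cancel_left, inner_neg_right, inner_smul_right]
        linarith [mul_pos ht hv]))
      rwa [sub_right_comm, inner_sub_right, inner_smul_right] at this
  have hlim : ∀ a b : ℝ, Tendsto (fun t : ℝ => a + t * b) (𝓝[>] 0) (𝓝 a) := fun a b =>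
    (Continuous.tendsto' (by fun_prop) _ _ (by simp)).mono_left nhdsWithin_le_nhds
  have hpq : ⟪μ, p - q⟫ = 0 := by
    refine le_antisymm ?_ ?_
    · refine le_of_tendsto (hlim _ (-⟪μ, ν⟫)) ?_
      filter_upwards [key ν hνν] with t ht
      linarith [ht.2]
    · refine ge_of_tendsto (hlim _ ⟪μ, ν⟫) ?_
      filter_upwards [key ν hνν] with t ht using ht.1
  have hnonneg : ∀ v, 0 < ⟪ν, v⟫ → 0 ≤ ⟪μ, v⟫ := by
    intro v hv
    obtain ⟨t, ⟨ht, -⟩, ht0⟩ := ((key v hv).and self_mem_nhdsWithin).exists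
    rw [hpq, zero_add] at ht
    exact nonneg_of_mul_nonneg_right ht ht0
  have hnonneg' : ∀ v, ⟪ν, v⟫ = 0 → 0 ≤ ⟪μ, v⟫ := by
    intro v hv
    refine ge_of_tendsto (hlim _ ⟪μ, ν⟫) ?_
    filter_upwards [self_mem_nhdsWithin] with t ht
    have := hnonneg (v + t • ν) (by
      rw [inner_add_right, inner_smul_right, hv, zero_add]
      exact mul_pos ht hνν)
    rwa [inner_add_right, inner_smul_right] at this
  have hle : ∀ v, ⟪ν, v⟫ = 0 → ⟪μ, v⟫ = 0 := by
    intro v hv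
    refine le_antisymm ?_ (hnonneg' v hv)
    have := hnonneg' (-v) (by simp [hv])
    simpa using this
  refine AffineSubspace.eq_of_direction_eq_of_nonempty_of_le ?_ ⟨p, mem_normalLine.2 (by simp)⟩ ?_
  · refine Submodule.eq_of_le_of_finrank_eq (fun x hx => ?_) ?_
    · rw [normalLine, AffineSubspace.direction_mk',
        Submodule.mem_orthogonal_singleton_iff_inner_right] at hx ⊢
      exact hle x hx
    · rw [finrank_direction_normalLine hν, finrank_direction_normalLine hμ]
  · intro x hx
    rw [mem_normalLine] at hx ⊢
    rw [← sub_add_sub_cancel x p q, inner_add_right, hpq, hle _ hx, add_zero]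

/-! ### Cells cut out by half-planes -/

section Cell

variable {ι : Type*} (G : SimpleGraph ι) (ν p : ι → ι → EuclideanSpace ℝ (Fin 2))

/-- The intersection of the open half-planes with inner normals `ν u v` through `p u v`, for `v`
adjacent to `u`. -/
def cell (u : ι) : Set (EuclideanSpace ℝ (Fin 2)) :=
  {x | ∀ v, G.Adj u v → 0 < ⟪ν u v, x - p u v⟫}

theorem convex_cell (u : ι) : Convex ℝ (cell G ν p u) := by
  intro x hx y hy a b ha hb hab v huv
  have : a • x + b • y - p u v = a • (x - p u v) + b • (y - p u v) := by
    obtain rfl := eq_sub_of_add_eq hab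
    module
  rw [this, inner_add_right, inner_smul_right, inner_smul_right]
  have h1 := hx v huv
  have h2 := hy v huv
  rcases ha.eq_or_lt with rfl | ha
  · obtain rfl : b = 1 := by linarith
    simpa using h2
  · have := mul_pos ha h1
    have := mul_nonneg hb h2.le
    linarith

theorem isOpen_cell [Finite ι] (u : ι) : IsOpen (cell G ν p u) := by
  simp only [cell, ofPred_forall]
  refine isOpen_iInter_of_finite fun v => isOpen_iInter_of_finite fun _ => ?_
  exact isOpen_lt (by fun_prop) (by fun_prop)

variable {G ν p}

theorem eventually_mem_cell_iff [Finite ι] {u v : ι} (huv : G.Adj u v)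
    (hpos : ∀ w, G.Adj u w → w ≠ v → 0 < ⟪ν u w, p u v - p u w⟫) :
    ∀ᶠ x in 𝓝 (p u v), (x ∈ cell G ν p u ↔ 0 < ⟪ν u v, x - p u v⟫) := by
  have h : ∀ᶠ x in 𝓝 (p u v), ∀ w, G.Adj u w → w ≠ v → 0 < ⟪ν u w, x - p u w⟫ := by
    simp only [eventually_all]
    intro w huw hwv
    exact ContinuousAt.eventually_lt (by fun_prop) (by fun_prop) (hpos w huw hwv)
  filter_upwards [h] with x hx
  refine ⟨fun h => h v huv, fun h w huw => ?_⟩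
  obtain rfl | hwv := eq_or_ne w v
  · exact h
  · exact hx w huw hwv

theorem eventually_notMem_cell {w z : ι} (hwz : G.Adj w z) {q : EuclideanSpace ℝ (Fin 2)}
    (hneg : ⟪ν w z, q - p w z⟫ < 0) : ∀ᶠ x in 𝓝 q, x ∉ cell G ν p w := by
  have : ∀ᶠ x in 𝓝 q, ⟪ν w z, x - p w z⟫ < 0 :=
    ContinuousAt.eventually_lt (by fun_prop) (by fun_prop) hneg
  filter_upwards [this] with x hx hmem
  exact (hmem z hwz).not_gt hx

/-- For cells touching generically along the edges of a complete multipartite graph, the ordinary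
lines of the complement correspond to the edges. -/
theorem encard_ordinary_lines_cell [Finite ι] (hν : ∀ u v, ν v u = -ν u v)
    (hp : ∀ u v, p v u = p u v) (hG : ∀ u v w, G.Adj u v → G.Adj w u ∨ G.Adj w v)
    (hν0 : ∀ u v, G.Adj u v → ν u v ≠ 0)
    (hpos : ∀ u v w, G.Adj u v → G.Adj u w → w ≠ v → 0 < ⟪ν u w, p u v - p u w⟫)
    (hne : ∀ u v z w, G.Adj u v → G.Adj z w → s(u, v) ≠ s(z, w) → ⟪ν z w, p u v - p z w⟫ ≠ 0)
    (hmeet : ∀ u v, ¬ G.Adj u v → (cell G ν p u ∩ cell G ν p v).Nonempty) :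
    {H : AffineSubspace ℝ (EuclideanSpace ℝ (Fin 2)) |
      IsOrdinaryFlat (⋃ u, cell G ν p u)ᶜ 1 H}.encard = G.edgeSet.encard := by
  let line : Sym2 ι → AffineSubspace ℝ (EuclideanSpace ℝ (Fin 2)) :=
    Sym2.lift ⟨fun u v => normalLine (ν u v) (p u v), fun u v => by
      simp only [hν u v, hp u v, normalLine_neg]⟩
  have hline : ∀ u v, line s(u, v) = normalLine (ν u v) (p u v) := fun _ _ => rfl
  have hinj : InjOn line G.edgeSet := by
    rintro ⟨u, v⟩ huv ⟨z, w⟩ hzw h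
    by_contra hcon
    refine hne u v z w huv hzw hcon (mem_normalLine.1 ?_)
    change normalLine (ν u v) (p u v) = normalLine (ν z w) (p z w) at h
    rw [← h, mem_normalLine, sub_self, inner_zero_right]
  rw [← hinj.encard_image]
  congr 1
  have hcell : ∀ u v, G.Adj u v →
      (∀ᶠ x in 𝓝 (p u v), (x ∈ cell G ν p u ↔ 0 < ⟪ν u v, x - p u v⟫)) ∧
      ∀ᶠ x in 𝓝 (p u v), (x ∈ cell G ν p v ↔ ⟪ν u v, x - p u v⟫ < 0) := by
    intro u v huv
    refine ⟨eventually_mem_cell_iff huv fun w => hpos u v w huv, ?_⟩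
    have := eventually_mem_cell_iff huv.symm fun w => hpos v u w huv.symm
    simpa [hν u v, hp u v, inner_neg_left] using this
  ext H
  constructor
  · rintro ⟨hH, q, hqS, -, U, hU, hqU, hSU⟩
    obtain ⟨μ, hμ, rfl⟩ := exists_eq_normalLine hH (hSU.subset ⟨hqS, hqU⟩).1
    obtain ⟨u, hu⟩ := exists_supported_of_inter_eq (convex_cell G ν p) hμ hU hqU hSU
    obtain ⟨v, hv⟩ := exists_supported_of_inter_eq (convex_cell G ν p) (neg_ne_zero.2 hμ) hU hqU
      (by rwa [normalLine_neg])
    simp only [inner_neg_left, Left.nonneg_neg_iff] at hv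
    have huv : G.Adj u v := by
      by_contra hcon
      obtain ⟨c, hc⟩ := hmeet u v hcon
      have hopen := ((isOpen_cell G ν p u).inter (isOpen_cell G ν p v)).mem_nhds hc
      have hc' : ∀ᶠ t in 𝓝[>] (0 : ℝ), c + t • μ ∈ cell G ν p u ∩ cell G ν p v :=
        (ContinuousAt.eventually_mem (f := fun t : ℝ => c + t • μ) (by fun_prop)
          (by simpa using hopen)).filter_mono nhdsWithin_le_nhds
      obtain ⟨t, ht, ht0⟩ := (hc'.and self_mem_nhdsWithin).exists
      have h1 := hu c hc.1
      have h2 := hv _ ht.2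
      rw [add_sub_right_comm, inner_add_right, inner_smul_right] at h2
      have := mul_pos ht0 (real_inner_self_pos.2 hμ)
      linarith
    refine ⟨s(u, v), huv, ?_⟩
    rw [hline]
    obtain ⟨h1, h2⟩ := hcell u v huv
    exact normalLine_eq_of_supported (hν0 u v huv) hμ (h1.mono fun x hx => hx.2)
      (h2.mono fun x hx => hx.2) hu hv
  · rintro ⟨⟨u, v⟩, huv, rfl⟩
    replace huv : G.Adj u v := huv
    change IsOrdinaryFlat _ 1 (normalLine (ν u v) (p u v))
    have hother : ∀ᶠ x in 𝓝 (p u v), ∀ w, w ≠ u → w ≠ v → x ∉ cell G ν p w := by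
      simp only [eventually_all]
      intro w hwu hwv
      rcases hG u v w huv with h | h
      · refine eventually_notMem_cell h ?_
        have := hpos u v w huv h.symm hwv
        rw [hν u w, hp u w, inner_neg_left]
        linarith
      · refine eventually_notMem_cell h ?_
        have := hpos v u w huv.symm h.symm hwu
        rw [hp u v] at this
        rw [hν v w, hp v w, inner_neg_left]
        linarith
    obtain ⟨h1, h2⟩ := hcell u v huv
    obtain ⟨U, hUsub, hU, hpU⟩ := _root_.eventually_nhds_iff.1 (h1.and (h2.and hother))
    have hSU : (⋃ u, cell G ν p u)ᶜ ∩ U =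
        (normalLine (ν u v) (p u v) : Set (EuclideanSpace ℝ (Fin 2))) ∩ U := by
      ext x
      simp only [mem_inter_iff, and_congr_left_iff, SetLike.mem_coe, mem_normalLine]
      intro hxU
      obtain ⟨hxu, hxv, hxw⟩ := hUsub x hxU
      rw [mem_compl_iff, mem_iUnion, not_exists]
      constructor
      · intro h
        refine le_antisymm (not_lt.1 fun h' => h u (hxu.2 h')) (not_lt.1 fun h' => h v (hxv.2 h'))
      · intro h w hw
        obtain rfl | hwu := eq_or_ne w u
        · exact (hxu.1 hw).ne' h
        obtain rfl | hwv := eq_or_ne w v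
        · exact (hxv.1 hw).ne h
        exact hxw w hwu hwv hw
    have hfin := finrank_direction_normalLine (hν0 u v huv) (p u v)
    have hpS := (hSU.superset ⟨mem_normalLine.2 (by simp), hpU⟩).1
    exact ⟨hfin, p u v, hpS, dmLoc_eq_one hfin hU hpU hpS hSU, U, hU, hpU, hSU⟩

end Cell

/-! ### Four regions, every two of which share a border segment

The region `0` is the triangle with vertices `(0,0)`, `(3,0)`, `(0,3)`; the regions `1`, `2`, `3` lie
beyond its sides and are separated from each other by rays starting at its vertices. -/

/-- First coordinates of the normals of the borders, pointing into the region of the row index. -/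
def baseNormalX : Fin 4 → Fin 4 → ℤ :=
  ![![0, 0, 1, -1], ![0, 0, 1, -1], ![-1, -1, 0, -2], ![1, 1, 2, 0]]

/-- Second coordinates of the normals of the borders. -/
def baseNormalY : Fin 4 → Fin 4 → ℤ :=
  ![![0, 1, 0, -1], ![-1, 0, -1, -2], ![0, 1, 0, -1], ![1, 2, 1, 0]]

/-- First coordinates of points on the borders. -/
def basePointX : Fin 4 → Fin 4 → ℤ :=
  ![![0, 1, 0, 1], ![1, 0, -1, 5], ![0, -1, 0, -1], ![1, 5, -1, 0]]

/-- Second coordinates of points on the borders. -/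
def basePointY : Fin 4 → Fin 4 → ℤ :=
  ![![0, 0, 1, 2], ![0, 0, -1, -1], ![1, -1, 0, 5], ![2, -1, 5, 0]]

/-- First coordinates of interior points of the regions. -/
def baseCenterX : Fin 4 → ℤ := ![1, 1, -1, 3]

/-- Second coordinates of interior points of the regions. -/
def baseCenterY : Fin 4 → ℤ := ![1, -1, 1, 3]

theorem baseNormalX_swap : ∀ X Y, baseNormalX Y X = -baseNormalX X Y := by decide

theorem baseNormalY_swap : ∀ X Y, baseNormalY Y X = -baseNormalY X Y := by decide

theorem basePointX_swap : ∀ X Y, basePointX Y X = basePointX X Y := by decide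

theorem basePointY_swap : ∀ X Y, basePointY Y X = basePointY X Y := by decide

theorem base_diagonal : ∀ X, baseNormalX X X = 0 ∧ baseNormalY X X = 0 ∧
    basePointX X X = 0 ∧ basePointY X X = 0 := by decide

theorem baseNormal_sq_ne_zero : ∀ X Y, X ≠ Y → baseNormalX X Y ^ 2 + baseNormalY X Y ^ 2 ≠ 0 := by
  decide

theorem basePoint_pos : ∀ X Y Z, X ≠ Y → X ≠ Z → Y ≠ Z →
    0 < baseNormalX X Z * (basePointX X Y - basePointX X Z) +
      baseNormalY X Z * (basePointY X Y - basePointY X Z) := by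
  decide

theorem baseCenter_pos : ∀ X Z, X ≠ Z →
    0 < baseNormalX X Z * (baseCenterX X - basePointX X Z) +
      baseNormalY X Z * (baseCenterY X - basePointY X Z) := by
  decide

theorem basePoint_ne : ∀ X Y Z W, X < Y → Z < W → ¬ (X = Z ∧ Y = W) →
    baseNormalX Z W * (basePointX X Y - basePointX Z W) +
      baseNormalY Z W * (basePointY X Y - basePointY Z W) ≠ 0 := by
  decide

/-! ### Splitting each border into many segments

In coordinates `(s, t)` along and across a border, the line with parameters `i` and `τ` is the graph
of `s ↦ 2 (s - i) ^ 2 - s ^ 2 - (s - i - τ) ^ 2`, rescaled by `η`, and its contact point has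
`s = i + τ`. For fixed `i` these lines envelop a short convex arc tangent to `t = - s ^ 2` at
`s = i`. -/

theorem inner_euclidean_plane (x y : EuclideanSpace ℝ (Fin 2)) :
    ⟪x, y⟫ = x 0 * y 0 + x 1 * y 1 := by
  simp only [PiLp.inner_apply, Fin.sum_univ_two, RCLike.inner_apply, conj_trivial]
  ring

/-- The normal of the line with parameters `i`, `τ` on the border between `X` and `Y`. -/
noncomputable def tiltedNormal (X Y : Fin 4) (i τ η : ℝ) : EuclideanSpace ℝ (Fin 2) :=
  let a : ℝ := baseNormalX X Y
  let b : ℝ := baseNormalY X Y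
  !₂[a + η * (2 * τ - 2 * i) * b / (a ^ 2 + b ^ 2),
    b - η * (2 * τ - 2 * i) * a / (a ^ 2 + b ^ 2)]

/-- The contact point on the line with parameters `i`, `τ` on the border between `X` and `Y`. -/
noncomputable def contactPoint (X Y : Fin 4) (i τ η : ℝ) : EuclideanSpace ℝ (Fin 2) :=
  let a : ℝ := baseNormalX X Y
  let b : ℝ := baseNormalY X Y
  !₂[basePointX X Y - η * (i + τ) * b +
      η ^ 2 * (2 * τ ^ 2 - (i + τ) ^ 2) * a / (a ^ 2 + b ^ 2),
    basePointY X Y + η * (i + τ) * a +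
      η ^ 2 * (2 * τ ^ 2 - (i + τ) ^ 2) * b / (a ^ 2 + b ^ 2)]

theorem inner_tiltedNormal_contactPoint {X Y : Fin 4} (hXY : X ≠ Y) (i τ i' τ' η : ℝ) :
    ⟪tiltedNormal X Y i' τ' η, contactPoint X Y i τ η - contactPoint X Y i' τ' η⟫ =
      -(η ^ 2 * ((i - i') ^ 2 + 2 * (i - i') * (τ + τ') - (τ - τ') ^ 2)) := by
  have h : (baseNormalX X Y : ℝ) ^ 2 + (baseNormalY X Y : ℝ) ^ 2 ≠ 0 := by
    exact_mod_cast baseNormal_sq_ne_zero X Y hXY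
  simp only [inner_euclidean_plane, tiltedNormal, contactPoint, PiLp.sub_apply]
  simp
  field_simp
  ring

theorem continuous_tiltedNormal (X Y : Fin 4) (i τ : ℝ) : Continuous (tiltedNormal X Y i τ) := by
  refine (PiLp.continuous_toLp 2 _).comp (continuous_pi fun k => ?_)
  fin_cases k <;> simp <;> fun_prop

theorem continuous_contactPoint (X Y : Fin 4) (i τ : ℝ) : Continuous (contactPoint X Y i τ) := by
  refine (PiLp.continuous_toLp 2 _).comp (continuous_pi fun k => ?_)
  fin_cases k <;> simp <;> fun_prop

theorem tiltedNormal_zero (X Y : Fin 4) (i τ : ℝ) :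
    tiltedNormal X Y i τ 0 = !₂[(baseNormalX X Y : ℝ), (baseNormalY X Y : ℝ)] := by
  simp [tiltedNormal]

theorem contactPoint_zero (X Y : Fin 4) (i τ : ℝ) :
    contactPoint X Y i τ 0 = !₂[(basePointX X Y : ℝ), (basePointY X Y : ℝ)] := by
  simp [contactPoint]

theorem tiltedNormal_ne_zero {X Y : Fin 4} (hXY : X ≠ Y) (i τ η : ℝ) :
    tiltedNormal X Y i τ η ≠ 0 := by
  intro h
  have hab : (baseNormalX X Y : ℝ) ^ 2 + (baseNormalY X Y : ℝ) ^ 2 ≠ 0 := by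
    exact_mod_cast baseNormal_sq_ne_zero X Y hXY
  have h0 := congrArg (fun x : EuclideanSpace ℝ (Fin 2) =>
    (baseNormalX X Y : ℝ) * x 0 + baseNormalY X Y * x 1) h
  simp only [tiltedNormal] at h0
  simp at h0
  apply hab
  rw [← h0]
  ring

theorem separation_pos {m k : ℕ} (hmk : m ≠ k) {τ τ' : ℝ} (hτ : 0 ≤ τ) (hτ5 : τ ≤ 1 / 5)
    (hτ' : 0 ≤ τ') (hτ5' : τ' ≤ 1 / 5) :
    0 < ((m : ℝ) - k) ^ 2 + 2 * ((m : ℝ) - k) * (τ + τ') - (τ - τ') ^ 2 := by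
  have hsq : (τ - τ') ^ 2 ≤ 1 / 25 := by nlinarith
  rcases hmk.lt_or_gt with h | h
  · have : (m : ℝ) + 1 ≤ k := by exact_mod_cast h
    nlinarith
  · have : (k : ℝ) + 1 ≤ m := by exact_mod_cast h
    nlinarith

/-- The small parameter attached to the `k`-th cell. -/
noncomputable def offset (k : ℕ) : ℝ := 1 / (k + 5)

theorem offset_nonneg (k : ℕ) : 0 ≤ offset k := by
  unfold offset
  positivity

theorem offset_le (k : ℕ) : offset k ≤ 1 / 5 := by
  unfold offset
  gcongr
  simp

theorem offset_injective : Function.Injective offset := by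
  intro k m h
  simpa [offset] using h

section Family

variable {n : ℕ}

/-- The region whose cell number `u` is a perturbation of. -/
def region (u : Fin n) : Fin 4 := Fin.ofNat 4 u

theorem turanGraph_adj_iff_region {u v : Fin n} :
    (SimpleGraph.turanGraph n 4).Adj u v ↔ region u ≠ region v := by
  simp [SimpleGraph.turanGraph_adj, region, Fin.ext_iff]

/-- The normal of the line separating the cells `u` and `v`, pointing towards `u`. -/
noncomputable def cellNormal (η : ℝ) (u v : Fin n) : EuclideanSpace ℝ (Fin 2) :=
  if region u < region v then tiltedNormal (region u) (region v) (u : ℕ) (offset v) η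
  else if region v < region u then -tiltedNormal (region v) (region u) (v : ℕ) (offset u) η
  else 0

/-- The point at which the cells `u` and `v` touch. -/
noncomputable def cellContact (η : ℝ) (u v : Fin n) : EuclideanSpace ℝ (Fin 2) :=
  if region u < region v then contactPoint (region u) (region v) (u : ℕ) (offset v) η
  else if region v < region u then contactPoint (region v) (region u) (v : ℕ) (offset u) η
  else 0

theorem cellNormal_swap (η : ℝ) (u v : Fin n) : cellNormal η v u = -cellNormal η u v := by
  rcases lt_trichotomy (region u) (region v) with h | h | h <;>
    simp [cellNormal, h, h.not_gt]

theorem cellContact_swap (η : ℝ) (u v : Fin n) : cellContact η v u = cellContact η u v := by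
  rcases lt_trichotomy (region u) (region v) with h | h | h <;>
    simp [cellContact, h, h.not_gt]

theorem continuous_cellNormal (u v : Fin n) : Continuous fun η => cellNormal η u v := by
  unfold cellNormal
  split_ifs
  · exact continuous_tiltedNormal _ _ _ _
  · exact (continuous_tiltedNormal _ _ _ _).neg
  · exact continuous_const

theorem continuous_cellContact (u v : Fin n) : Continuous fun η => cellContact η u v := by
  unfold cellContact
  split_ifs
  · exact continuous_contactPoint _ _ _ _
  · exact continuous_contactPoint _ _ _ _
  · exact continuous_const

theorem cellNormal_zero (u v : Fin n) : cellNormal 0 u v =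
    !₂[(baseNormalX (region u) (region v) : ℝ), (baseNormalY (region u) (region v) : ℝ)] := by
  rcases lt_trichotomy (region u) (region v) with h | h | h
  · simp [cellNormal, h, tiltedNormal_zero]
  · ext k
    fin_cases k <;> simp [cellNormal, h, base_diagonal]
  · ext k
    rw [baseNormalX_swap (region v), baseNormalY_swap (region v)]
    fin_cases k <;> simp [cellNormal, h, h.not_gt, tiltedNormal_zero]

theorem cellContact_zero (u v : Fin n) : cellContact 0 u v =
    !₂[(basePointX (region u) (region v) : ℝ), (basePointY (region u) (region v) : ℝ)] := by
  rcases lt_trichotomy (region u) (region v) with h | h | h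
  · simp [cellContact, h, contactPoint_zero]
  · ext k
    fin_cases k <;> simp [cellContact, h, base_diagonal]
  · rw [basePointX_swap (region v), basePointY_swap (region v)]
    simp [cellContact, h, h.not_gt, contactPoint_zero]

theorem cellNormal_ne_zero {u v : Fin n} (h : region u ≠ region v) (η : ℝ) :
    cellNormal η u v ≠ 0 := by
  rcases h.lt_or_gt with h | h
  · simpa [cellNormal, h] using tiltedNormal_ne_zero h.ne _ _ _
  · simpa [cellNormal, h, h.not_gt] using tiltedNormal_ne_zero h.ne _ _ _

theorem inner_cellContact_pos {η : ℝ} (hη : 0 < η) {u v w : Fin n} (huv : region u ≠ region v)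
    (hvw : region v = region w) (hne : w ≠ v) :
    0 < ⟪cellNormal η u w, cellContact η u v - cellContact η u w⟫ := by
  have hne' : (v : ℕ) ≠ w := fun h => hne (Fin.ext h.symm)
  rcases huv.lt_or_gt with h | h
  · simp only [cellNormal, cellContact, ← hvw, h, if_true]
    rw [inner_tiltedNormal_contactPoint h.ne]
    have := sub_ne_zero.2 (offset_injective.ne hne')
    have : 0 < (offset v - offset w) ^ 2 := by positivity
    nlinarith [mul_pos (pow_pos hη 2) this]
  · simp only [cellNormal, cellContact, ← hvw, h, h.not_gt, if_true, if_false]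
    rw [inner_neg_left, inner_tiltedNormal_contactPoint h.ne, neg_neg]
    exact mul_pos (pow_pos hη 2) (separation_pos hne' (offset_nonneg _) (offset_le _)
      (offset_nonneg _) (offset_le _))

theorem inner_cellContact_ne {η : ℝ} (hη : 0 < η) {u v z w : Fin n} (huv : region u < region v)
    (huz : region u = region z) (hvw : region v = region w) (hne : ¬ (u = z ∧ v = w)) :
    ⟪cellNormal η z w, cellContact η u v - cellContact η z w⟫ ≠ 0 := by
  simp only [cellNormal, cellContact, ← hvw, ← huz, huv, if_true]
  rw [inner_tiltedNormal_contactPoint huv.ne, neg_ne_zero]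
  refine mul_ne_zero (by positivity) ?_
  by_cases h : u = z
  · subst h
    have hvw' : (v : ℕ) ≠ w := fun h => hne ⟨rfl, Fin.ext h⟩
    simpa using sub_ne_zero.2 (offset_injective.ne hvw')
  · exact (separation_pos (fun h' => h (Fin.ext h')) (offset_nonneg _) (offset_le _)
      (offset_nonneg _) (offset_le _)).ne'

theorem eventually_inner_cellContact_pos (u v w : Fin n) (huv : region u ≠ region v)
    (huw : region u ≠ region w) (hne : w ≠ v) :
    ∀ᶠ η in 𝓝[>] (0 : ℝ), 0 < ⟪cellNormal η u w, cellContact η u v - cellContact η u w⟫ := by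
  by_cases hvw : region v = region w
  · filter_upwards [self_mem_nhdsWithin] with η hη
    exact inner_cellContact_pos hη huv hvw hne
  refine (ContinuousAt.eventually_lt (f := fun _ : ℝ => (0 : ℝ)) continuousAt_const
    ((continuous_cellNormal u w).inner ((continuous_cellContact u v).sub
      (continuous_cellContact u w))).continuousAt ?_).filter_mono nhdsWithin_le_nhds
  rw [inner_euclidean_plane, Pi.sub_apply, cellNormal_zero, cellContact_zero, cellContact_zero]
  simpa using (Int.cast_pos (R := ℝ)).2 (basePoint_pos _ _ _ huv huw hvw)

theorem eventually_inner_cellContact_ne_of_lt (u v z w : Fin n) (huv : region u < region v)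
    (hzw : region z < region w) (hne : ¬ (u = z ∧ v = w)) :
    ∀ᶠ η in 𝓝[>] (0 : ℝ), ⟪cellNormal η z w, cellContact η u v - cellContact η z w⟫ ≠ 0 := by
  by_cases h : region u = region z ∧ region v = region w
  · filter_upwards [self_mem_nhdsWithin] with η hη
    exact inner_cellContact_ne hη huv h.1 h.2 hne
  refine (ContinuousAt.eventually_ne ((continuous_cellNormal z w).inner
    ((continuous_cellContact u v).sub (continuous_cellContact z w))).continuousAt
    ?_).filter_mono nhdsWithin_le_nhds
  rw [inner_euclidean_plane, Pi.sub_apply, cellNormal_zero, cellContact_zero, cellContact_zero]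
  simpa using (Int.cast_ne_zero (α := ℝ)).2 (basePoint_ne _ _ _ _ huv hzw h)

theorem eventually_inner_cellContact_ne (u v z w : Fin n) (huv : region u ≠ region v)
    (hzw : region z ≠ region w) (hne : s(u, v) ≠ s(z, w)) :
    ∀ᶠ η in 𝓝[>] (0 : ℝ), ⟪cellNormal η z w, cellContact η u v - cellContact η z w⟫ ≠ 0 := by
  wlog huv' : region u < region v generalizing u v
  · simpa only [cellContact_swap _ u v] using this v u huv.symm (Sym2.eq_swap ▸ hne)
      (huv.lt_or_gt.resolve_left huv')
  wlog hzw' : region z < region w generalizing z w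
  · simpa only [cellContact_swap _ z w, cellNormal_swap _ z w, inner_neg_left, neg_ne_zero] using
      this w z hzw.symm (Sym2.eq_swap (a := z) ▸ hne) (hzw.lt_or_gt.resolve_left hzw')
  refine eventually_inner_cellContact_ne_of_lt u v z w huv' hzw' ?_
  rintro ⟨rfl, rfl⟩
  exact hne rfl

theorem eventually_mem_cell_center (u : Fin n) :
    ∀ᶠ η in 𝓝[>] (0 : ℝ),
      !₂[(baseCenterX (region u) : ℝ), (baseCenterY (region u) : ℝ)] ∈
        cell (SimpleGraph.turanGraph n 4) (cellNormal η) (cellContact η) u := by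
  simp only [cell, mem_ofPred_eq, eventually_all]
  intro v huv
  refine (ContinuousAt.eventually_lt (f := fun _ : ℝ => (0 : ℝ)) continuousAt_const
    ((continuous_cellNormal u v).inner (continuous_const.sub
      (continuous_cellContact u v))).continuousAt ?_).filter_mono nhdsWithin_le_nhds
  rw [inner_euclidean_plane, Pi.sub_apply, cellNormal_zero, cellContact_zero]
  simpa using (Int.cast_pos (R := ℝ)).2 (baseCenter_pos _ _ (turanGraph_adj_iff_region.1 huv))

end Family

theorem exists_convex_encard_ordinary_lines_eq (n : ℕ) :
    ∃ K : Fin n → Set (EuclideanSpace ℝ (Fin 2)),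
      (∀ i, Convex ℝ (K i)) ∧
      {H : AffineSubspace ℝ (EuclideanSpace ℝ (Fin 2)) |
        IsOrdinaryFlat (⋃ i, K i)ᶜ 1 H}.encard = (turanNumber4 n : ℕ∞) := by
  have hpos : ∀ᶠ η in 𝓝[>] (0 : ℝ), ∀ u v w : Fin n, region u ≠ region v → region u ≠ region w →
      w ≠ v → 0 < ⟪cellNormal η u w, cellContact η u v - cellContact η u w⟫ := by
    simpa only [eventually_all] using eventually_inner_cellContact_pos
  have hne : ∀ᶠ η in 𝓝[>] (0 : ℝ), ∀ u v z w : Fin n, region u ≠ region v → region z ≠ region w →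
      s(u, v) ≠ s(z, w) →
      ⟪cellNormal η z w, cellContact η u v - cellContact η z w⟫ ≠ 0 := by
    simpa only [eventually_all] using eventually_inner_cellContact_ne
  obtain ⟨η, hpos, hne, hcenter⟩ :=
    (hpos.and (hne.and (eventually_all.2 (eventually_mem_cell_center (n := n))))).exists
  refine ⟨cell (SimpleGraph.turanGraph n 4) (cellNormal η) (cellContact η),
    convex_cell _ _ _, ?_⟩
  rw [turanNumber4_eq, (Set.toFinite _).cast_ncard_eq]
  refine encard_ordinary_lines_cell (cellNormal_swap η) (cellContact_swap η) ?_ ?_ ?_ ?_ ?_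
  all_goals simp only [turanGraph_adj_iff_region]
  · intro u v w huv
    by_contra! h
    exact huv (h.1.symm.trans h.2)
  · exact fun u v huv => cellNormal_ne_zero huv η
  · exact hpos
  · exact hne
  · intro u v huv
    exact ⟨_, hcenter u, by simpa only [not_not.1 huv] using hcenter v⟩

end OrdinaryLines

/-- For every `n ≥ 4` there exist `n` convex sets in the plane whose complement has
exactly `t(n,4)` ordinary lines (`1`-ordinary flats). -/
theorem exists_ordinary_lines_card_eq_turan (n : ℕ) (hn : 4 ≤ n) :
    ∃ K : Fin n → Set (EuclideanSpace ℝ (Fin 2)),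
      (∀ i, Convex ℝ (K i)) ∧
      {H : AffineSubspace ℝ (EuclideanSpace ℝ (Fin 2)) |
        IsOrdinaryFlat (⋃ i, K i)ᶜ 1 H}.encard = (turanNumber4 n : ℕ∞) := by
  exact exists_convex_encard_ordinary_lines_eq n
end

section
/- Let K₁, K₂ ⊆ ℝ^d be convex sets and let S = ℝ^d \ (K₁ ∪ K₂). If J₁ and J₂ are ordinary flats of S (of any dimensions), then J₁ ⊆ J₂ or J₂ ⊆ J₁. -/
open Metric Set Module

section LocalSeparation

open Topology Filter

variable {E : Type*} [NormedAddCommGroup E] [NormedSpace ℝ E]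

/-- In finite dimension, a point outside a convex set is weakly separated from it by a
nonzero functional. -/
theorem Convex.exists_ne_zero_forall_le_of_notMem [FiniteDimensional ℝ E] [Nontrivial E]
    {K : Set E} (hK : Convex ℝ K) {p : E} (hp : p ∉ K) :
    ∃ f : StrongDual ℝ E, f ≠ 0 ∧ ∀ x ∈ K, f x ≤ f p := by
  by_cases hint : (interior K).Nonempty
  · obtain ⟨f, hf, h⟩ := geometric_hahn_banach_of_nonempty_interior_point hK
      (fun h => hp (interior_subset h)) hint
    exact ⟨f, hf, h⟩
  have hlt : vectorSpan ℝ K < ⊤ := by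
    rcases K.eq_empty_or_nonempty with rfl | hne
    · simp [bot_lt_top]
    rw [hK.interior_nonempty_iff_affineSpan_eq_top] at hint
    rw [lt_top_iff_ne_top, ← direction_affineSpan]
    intro h
    exact hint ((AffineSubspace.direction_eq_top_iff_of_nonempty
      ((affineSpan_nonempty ℝ).2 hne)).1 h)
  obtain ⟨g, hg, hle⟩ := Submodule.exists_le_ker_of_lt_top _ hlt
  have hconst : ∀ x ∈ K, ∀ y ∈ K, g x = g y := fun x hx y hy => by
    have := hle (vsub_mem_vectorSpan ℝ hx hy)
    simpa [sub_eq_zero] using this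
  have hg' : LinearMap.toContinuousLinearMap g ≠ 0 := by simpa using hg
  by_cases h : ∀ x ∈ K, g x ≤ g p
  · exact ⟨LinearMap.toContinuousLinearMap g, hg', h⟩
  · push Not at h
    obtain ⟨y, hy, hlt⟩ := h
    refine ⟨-LinearMap.toContinuousLinearMap g, neg_ne_zero.2 hg', fun x hx => ?_⟩
    simpa [hconst x hx y hy] using hlt.le

theorem StrongDual.exists_pos {f : StrongDual ℝ E} (hf : f ≠ 0) : ∃ u, 0 < f u := by
  obtain ⟨u, hu⟩ := DFunLike.ne_iff.1 hf
  rcases lt_or_gt_of_ne hu with h | h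
  · exact ⟨-u, by simpa using h⟩
  · exact ⟨u, by simpa using h⟩

theorem tendsto_add_smul_nhdsGT_zero (p v : E) :
    Tendsto (fun t : ℝ => p + t • v) (𝓝[>] 0) (𝓝 p) := by
  have : Tendsto (fun t : ℝ => p + t • v) (𝓝 0) (𝓝 (p + (0 : ℝ) • v)) :=
    Continuous.tendsto (by fun_prop) 0
  simpa using this.mono_left nhdsWithin_le_nhds

theorem StrongDual.eventually_pos_add_smul {f : StrongDual ℝ E} {v : E} (hv : 0 < f v) (w : E) :
    ∀ᶠ t : ℝ in 𝓝[>] 0, 0 < f (v + t • w) :=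
  ((f.continuous.tendsto v).comp (tendsto_add_smul_nhdsGT_zero v w)).eventually_const_lt hv

theorem AffineSubspace.add_smul_mem_iff {J : AffineSubspace ℝ E} {p v : E} (hp : p ∈ J) {t : ℝ}
    (ht : t ≠ 0) : p + t • v ∈ J ↔ v ∈ J.direction := by
  rw [add_comm, ← vadd_eq_add, AffineSubspace.vadd_mem_iff_mem_direction _ hp,
    Submodule.smul_mem_iff _ ht]

/-- `T` agrees, near its point `p`, with the complement of the affine subspace `J`. -/
def IsLocallyComplFlat (T : Set E) (J : AffineSubspace ℝ E) (p : E) : Prop :=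
  p ∈ J ∧ ∀ᶠ x in 𝓝 p, x ∈ T ↔ x ∉ J

namespace IsLocallyComplFlat

variable {T K₁ K₂ : Set E} {J : AffineSubspace ℝ E} {p : E}

theorem notMem (h : IsLocallyComplFlat T J p) : p ∉ T := fun hp =>
  h.2.self_of_nhds.1 hp h.1

theorem swap (h : IsLocallyComplFlat (K₁ ∪ K₂) J p) : IsLocallyComplFlat (K₂ ∪ K₁) J p := by
  rwa [union_comm]

theorem eventually_mem (h : IsLocallyComplFlat T J p) {v : E} (hv : v ∉ J.direction) :
    ∀ᶠ t : ℝ in 𝓝[>] 0, p + t • v ∈ T := by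
  filter_upwards [(tendsto_add_smul_nhdsGT_zero p v).eventually h.2, self_mem_nhdsWithin]
    with t ht h0
  exact ht.2 fun hm => hv ((AffineSubspace.add_smul_mem_iff h.1 (ne_of_gt h0)).1 hm)

theorem eventually_notMem (h : IsLocallyComplFlat T J p) {v : E} (hv : v ∈ J.direction) :
    ∀ᶠ t : ℝ in 𝓝[>] 0, p + t • v ∉ T := by
  filter_upwards [(tendsto_add_smul_nhdsGT_zero p v).eventually h.2, self_mem_nhdsWithin]
    with t ht h0
  exact fun hm => ht.1 hm ((AffineSubspace.add_smul_mem_iff h.1 (ne_of_gt h0)).2 hv)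

theorem exists_notMem_direction (h : IsLocallyComplFlat T J p) (hJ : J ≠ ⊤) :
    ∃ w, w ∉ J.direction := by
  by_contra! hw
  exact hJ ((AffineSubspace.direction_eq_top_iff_of_nonempty ⟨p, h.1⟩).1
    (Submodule.eq_top_iff'.2 hw))

/-- The two convex sets are weakly separated by a hyperplane through `p`. -/
theorem exists_separating [FiniteDimensional ℝ E] (h : IsLocallyComplFlat (K₁ ∪ K₂) J p)
    (hK₁ : Convex ℝ K₁) (hK₂ : Convex ℝ K₂) (hJ : J ≠ ⊤) :
    ∃ f : StrongDual ℝ E, f ≠ 0 ∧ (∀ x ∈ K₁, f x ≤ f p) ∧ ∀ x ∈ K₂, f p ≤ f x := by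
  obtain ⟨w, hw⟩ := h.exists_notMem_direction hJ
  have : Nontrivial E := ⟨w, 0, fun h0 => hw (h0 ▸ zero_mem _)⟩
  obtain ⟨f, hf, hf₁⟩ := hK₁.exists_ne_zero_forall_le_of_notMem fun hp => h.notMem (.inl hp)
  obtain ⟨g, hg, hg₂⟩ := hK₂.exists_ne_zero_forall_le_of_notMem fun hp => h.notMem (.inr hp)
  have outside : ∀ v ∉ J.direction, 0 < f v → 0 < g v → False := fun v hv hfv hgv => by
    obtain ⟨t, ht, h0⟩ := ((h.eventually_mem hv).and self_mem_nhdsWithin).exists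
    have h0 : 0 < t := h0
    rcases ht with ht | ht
    · have := hf₁ _ ht
      simp only [map_add, map_smul, smul_eq_mul] at this
      nlinarith [mul_pos h0 hfv]
    · have := hg₂ _ ht
      simp only [map_add, map_smul, smul_eq_mul] at this
      nlinarith [mul_pos h0 hgv]
  have no_common : ∀ v, 0 < f v → 0 < g v → False := fun v hfv hgv => by
    by_cases hv : v ∈ J.direction
    · obtain ⟨t, ⟨hft, hgt⟩, h0⟩ := (((StrongDual.eventually_pos_add_smul hfv w).and
        (StrongDual.eventually_pos_add_smul hgv w)).and self_mem_nhdsWithin).exists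
      refine outside _ (fun hm => hw ?_) hft hgt
      rwa [Submodule.add_mem_iff_right _ hv, Submodule.smul_mem_iff _ (ne_of_gt h0)] at hm
    · exact outside v hv hfv hgv
  refine ⟨f, hf, hf₁, fun x hx => ?_⟩
  by_contra! hlt
  obtain ⟨u, hu⟩ := StrongDual.exists_pos hg
  obtain ⟨t, hft, h0⟩ := ((StrongDual.eventually_pos_add_smul (f := f) (v := p - x)
    (by simpa using hlt) u).and self_mem_nhdsWithin).exists
  refine no_common _ hft ?_
  have := hg₂ x hx
  simp only [map_add, map_sub, map_smul, smul_eq_mul]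
  nlinarith [mul_pos (show 0 < t from h0) hu]

section Separated

variable {f : StrongDual ℝ E}

theorem eventually_mem_left (h : IsLocallyComplFlat (K₁ ∪ K₂) J p)
    (hf₂ : ∀ x ∈ K₂, f p ≤ f x) {v : E} (hfv : f v < 0) (hv : v ∉ J.direction) :
    ∀ᶠ t : ℝ in 𝓝[>] 0, p + t • v ∈ K₁ := by
  filter_upwards [h.eventually_mem hv, self_mem_nhdsWithin] with t ht h0
  refine ht.resolve_right fun h₂ => ?_
  have := hf₂ _ h₂
  simp only [map_add, map_smul, smul_eq_mul] at this
  nlinarith [mul_pos_of_neg_of_neg hfv (neg_neg_of_pos (show 0 < t from h0))]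

theorem nonneg_of_mem_direction (h : IsLocallyComplFlat (K₁ ∪ K₂) J p)
    (hK₁ : Convex ℝ K₁) (hJ : J ≠ ⊤) (hf₂ : ∀ x ∈ K₂, f p ≤ f x) {v : E}
    (hv : v ∈ J.direction) : 0 ≤ f v := by
  by_contra! hlt
  obtain ⟨w, hw⟩ := h.exists_notMem_direction hJ
  have hpos : 0 < (-f) v := by simpa using hlt
  obtain ⟨s, ⟨hs₁, hs₂⟩, h0⟩ := (((StrongDual.eventually_pos_add_smul hpos w).and
    (StrongDual.eventually_pos_add_smul hpos (-w))).and self_mem_nhdsWithin).exists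
  have hs0 : s ≠ 0 := ne_of_gt h0
  have hd₁ : v + s • w ∉ J.direction := by
    rwa [Submodule.add_mem_iff_right _ hv, Submodule.smul_mem_iff _ hs0]
  have hd₂ : v + s • -w ∉ J.direction := by
    rwa [Submodule.add_mem_iff_right _ hv, Submodule.smul_mem_iff _ hs0, neg_mem_iff]
  obtain ⟨t, ⟨ht₁, ht₂⟩, ht⟩ :=
    (((h.eventually_mem_left hf₂ (neg_pos.1 hs₁) hd₁).and
      (h.eventually_mem_left hf₂ (neg_pos.1 hs₂) hd₂)).and (h.eventually_notMem hv)).exists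
  refine ht (.inl ?_)
  convert hK₁ ht₁ ht₂ (a := 1 / 2) (b := 1 / 2) (by norm_num) (by norm_num) (by norm_num) using 1
  module

theorem eq_zero_of_mem_direction (h : IsLocallyComplFlat (K₁ ∪ K₂) J p)
    (hK₁ : Convex ℝ K₁) (hJ : J ≠ ⊤) (hf₂ : ∀ x ∈ K₂, f p ≤ f x) {v : E}
    (hv : v ∈ J.direction) : f v = 0 :=
  le_antisymm (by simpa using h.nonneg_of_mem_direction hK₁ hJ hf₂ (neg_mem hv))
    (h.nonneg_of_mem_direction hK₁ hJ hf₂ hv)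

/-- Any functional bounded above on `K₁` is at most its bound at `p`, and if it attains this bound
at `p`, it is nonpositive on the half-space containing `K₁`. -/
theorem le_of_forall_le (h : IsLocallyComplFlat (K₁ ∪ K₂) J p)
    (hK₁ : Convex ℝ K₁) (hJ : J ≠ ⊤) (hf : f ≠ 0) (hf₂ : ∀ x ∈ K₂, f p ≤ f x)
    {g : StrongDual ℝ E} {c : ℝ} (hg : ∀ x ∈ K₁, g x ≤ c) :
    g p ≤ c ∧ (g p = c → ∀ v, f v < 0 → g v ≤ 0) := by
  have key : ∀ v, f v < 0 → ∀ᶠ t : ℝ in 𝓝[>] 0, g (p + t • v) ≤ c := fun v hv =>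
    (h.eventually_mem_left hf₂ hv fun hm =>
      hv.ne (h.eq_zero_of_mem_direction hK₁ hJ hf₂ hm)).mono fun t => hg _
  constructor
  · obtain ⟨u, hu⟩ := StrongDual.exists_pos hf
    exact le_of_tendsto ((g.continuous.tendsto p).comp (tendsto_add_smul_nhdsGT_zero p (-u)))
      (key (-u) (by simpa using hu))
  · intro hgp v hv
    obtain ⟨t, ht, h0⟩ := ((key v hv).and self_mem_nhdsWithin).exists
    simp only [map_add, map_smul, smul_eq_mul, hgp] at ht
    by_contra! hlt
    nlinarith [mul_pos (show 0 < t from h0) hlt]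

/-- A second hyperplane separating `K₁` and `K₂` coincides with the one through `p`. -/
theorem separating_unique (h : IsLocallyComplFlat (K₁ ∪ K₂) J p)
    (hK₁ : Convex ℝ K₁) (hK₂ : Convex ℝ K₂) (hJ : J ≠ ⊤) (hf : f ≠ 0)
    (hf₁ : ∀ x ∈ K₁, f x ≤ f p) (hf₂ : ∀ x ∈ K₂, f p ≤ f x)
    {g : StrongDual ℝ E} {c : ℝ} (hg : g ≠ 0) (hg₁ : ∀ x ∈ K₁, g x ≤ c)
    (hg₂ : ∀ x ∈ K₂, c ≤ g x) {x : E} (hx : g x = c) : f x = f p := by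
  obtain ⟨hle, himp⟩ := h.le_of_forall_le hK₁ hJ hf hf₂ hg₁
  have hge := (h.swap.le_of_forall_le (f := -f) (g := -g) (c := -c) hK₂ hJ (neg_ne_zero.2 hf)
    (fun x hx => by simpa using hf₁ x hx) fun x hx => by simpa using hg₂ x hx).1
  have hgp : g p = c := le_antisymm hle (by simpa using hge)
  obtain ⟨u, hu⟩ := StrongDual.exists_pos hg
  have ker_le : ∀ v, g v = 0 → 0 ≤ f v := fun v hv => by
    by_contra! hlt
    obtain ⟨t, ht, h0⟩ := ((StrongDual.eventually_pos_add_smul (f := -f) (v := v)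
      (by simpa using hlt) u).and self_mem_nhdsWithin).exists
    have := himp hgp _ (neg_pos.1 ht)
    simp only [map_add, map_smul, smul_eq_mul, hv] at this
    nlinarith [mul_pos (show 0 < t from h0) hu]
  have h₁ := ker_le (x - p) (by simp [hx, hgp])
  have h₂ := ker_le (p - x) (by simp [hx, hgp])
  simp only [map_sub] at h₁ h₂
  linarith

end Separated

theorem comap {F : Type*} [NormedAddCommGroup F] [NormedSpace ℝ F] (φ : F →ᴬ[ℝ] E) {q : F}
    (h : IsLocallyComplFlat T J (φ q)) :
    IsLocallyComplFlat (φ ⁻¹' T) (J.comap φ.toAffineMap) q :=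
  ⟨h.1, (φ.continuous.tendsto q).eventually h.2⟩

end IsLocallyComplFlat

theorem IsLocallyComplFlat.le_or_le {E : Type*} [NormedAddCommGroup E] [NormedSpace ℝ E]
    [FiniteDimensional ℝ E] {K₁ K₂ : Set E} (hK₁ : Convex ℝ K₁) (hK₂ : Convex ℝ K₂)
    {J₁ J₂ : AffineSubspace ℝ E} {p₁ p₂ : E} (h₁ : IsLocallyComplFlat (K₁ ∪ K₂) J₁ p₁)
    (h₂ : IsLocallyComplFlat (K₁ ∪ K₂) J₂ p₂) : J₁ ≤ J₂ ∨ J₂ ≤ J₁ := by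
  induction hn : finrank ℝ E using Nat.strong_induction_on generalizing E with
  | _ n ih =>
  by_cases hJ₁ : J₁ = ⊤
  · simp [hJ₁]
  by_cases hJ₂ : J₂ = ⊤
  · simp [hJ₂]
  obtain ⟨f, hf, hf₁, hf₂⟩ := h₁.exists_separating hK₁ hK₂ hJ₁
  obtain ⟨g, hg, hg₁, hg₂⟩ := h₂.exists_separating hK₁ hK₂ hJ₂
  have on₁ : ∀ x ∈ J₁, f x = f p₁ := fun x hx => by
    simpa [sub_eq_zero] using
      h₁.eq_zero_of_mem_direction hK₁ hJ₁ hf₂ (AffineSubspace.vsub_mem_direction hx h₁.1)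
  have on₂ : ∀ x ∈ J₂, f x = f p₁ := fun x hx =>
    h₁.separating_unique hK₁ hK₂ hJ₁ hf hf₁ hf₂ hg hg₁ hg₂ (by
      simpa [sub_eq_zero] using
        h₂.eq_zero_of_mem_direction hK₁ hJ₂ hg₂ (AffineSubspace.vsub_mem_direction hx h₂.1))
  let φ : f.ker →ᴬ[ℝ] E :=
    f.ker.subtypeL.toContinuousAffineMap + ContinuousAffineMap.const ℝ _ p₁
  have hφ : ∀ y, φ y = y + p₁ := fun y => rfl
  have lift : ∀ x, f x = f p₁ → ∃ y, φ y = x := fun x hx =>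
    ⟨⟨x - p₁, by simp [hx]⟩, by simp [hφ]⟩
  obtain ⟨q₁, hq₁⟩ := lift p₁ rfl
  obtain ⟨q₂, hq₂⟩ := lift p₂ (on₂ p₂ h₂.1)
  have hlt : finrank ℝ f.ker < n := by
    have := Module.Dual.finrank_ker_add_one_of_ne_zero (f := f.toLinearMap)
      (fun h => hf (ContinuousLinearMap.coe_injective h))
    rw [← hn, ← this]
    exact Nat.lt_succ_self _
  have h₁' : IsLocallyComplFlat (φ.toAffineMap ⁻¹' K₁ ∪ φ.toAffineMap ⁻¹' K₂)
      (J₁.comap φ.toAffineMap) q₁ :=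
    IsLocallyComplFlat.comap (T := K₁ ∪ K₂) φ (hq₁.symm ▸ h₁)
  have h₂' : IsLocallyComplFlat (φ.toAffineMap ⁻¹' K₁ ∪ φ.toAffineMap ⁻¹' K₂)
      (J₂.comap φ.toAffineMap) q₂ :=
    IsLocallyComplFlat.comap (T := K₁ ∪ K₂) φ (hq₂.symm ▸ h₂)
  refine (ih _ hlt (hK₁.affine_preimage φ.toAffineMap) (hK₂.affine_preimage φ.toAffineMap)
    h₁' h₂' rfl).imp (fun hle x hx => ?_) fun hle x hx => ?_
  · obtain ⟨y, rfl⟩ := lift x (on₁ x hx)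
    exact hle hx
  · obtain ⟨y, rfl⟩ := lift x (on₂ x hx)
    exact hle hx

theorem IsOrdinaryFlat.exists_isLocallyComplFlat {d k : ℕ}
    {T : Set (EuclideanSpace ℝ (Fin d))} {J : AffineSubspace ℝ (EuclideanSpace ℝ (Fin d))}
    (h : IsOrdinaryFlat Tᶜ k J) : ∃ p, IsLocallyComplFlat T J p := by
  obtain ⟨-, p, hp, -, U, hU, hpU, heq⟩ := h
  have hmem : ∀ x ∈ U, x ∈ T ↔ x ∉ J := fun x hx => by
    have := Set.ext_iff.1 heq x
    simp only [mem_inter_iff, mem_compl_iff, SetLike.mem_coe, hx, and_true] at this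
    tauto
  exact ⟨p, by_contra fun h => hp ((hmem p hpU).2 h), by
    filter_upwards [hU.mem_nhds hpU] using hmem⟩

end LocalSeparation

/-- For the complement `S` of a union of two convex sets in `ℝ^d`, any two ordinary
flats of `S` are comparable by inclusion. -/
theorem ordinary_flats_of_two_convex_comparable (d : ℕ)
    (K₁ K₂ : Set (EuclideanSpace ℝ (Fin d)))
    (hK₁ : Convex ℝ K₁) (hK₂ : Convex ℝ K₂)
    (J₁ J₂ : AffineSubspace ℝ (EuclideanSpace ℝ (Fin d)))
    (hJ₁ : ∃ k, IsOrdinaryFlat (K₁ ∪ K₂)ᶜ k J₁)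
    (hJ₂ : ∃ k, IsOrdinaryFlat (K₁ ∪ K₂)ᶜ k J₂) :
    J₁ ≤ J₂ ∨ J₂ ≤ J₁ := by
  obtain ⟨_, h₁⟩ := hJ₁
  obtain ⟨_, h₂⟩ := hJ₂
  obtain ⟨p₁, h₁⟩ := h₁.exists_isLocallyComplFlat
  obtain ⟨p₂, h₂⟩ := h₂.exists_isLocallyComplFlat
  exact h₁.le_or_le hK₁ hK₂ h₂
end

section
/- Let K₁, K₂ ⊆ ℝ^d be convex sets and let S = ℝ^d \ (K₁ ∪ K₂). Then for every 0 ≤ k ≤ d, the set S has at most one k-ordinary flat. -/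
open Metric Set Module

open AffineMap Filter Topology in
/-- A point of a line through `p` in the affine subspace `H`, other than `p`, lies in `H` only if
the whole line does. -/
lemma AffineSubspace.right_mem_of_lineMap_mem {V : Type*} [AddCommGroup V] [Module ℝ V]
    {H : AffineSubspace ℝ V} {p q : V} {t : ℝ} (ht : t ≠ 0) (hp : p ∈ H)
    (h : lineMap p q t ∈ H) : q ∈ H := by
  have hq : lineMap p (lineMap p q t) t⁻¹ = q := by
    simp [lineMap_apply, smul_smul, inv_mul_cancel₀ ht]
  exact hq ▸ lineMap_mem t⁻¹ hp h

open AffineMap Filter Topology in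
/-- If `H` is not contained in `H'`, then `H \ H'` is dense in `H`. -/
lemma AffineSubspace.exists_mem_notMem_of_not_le {V : Type*} [AddCommGroup V] [Module ℝ V]
    [TopologicalSpace V] [IsTopologicalAddGroup V] [ContinuousSMul ℝ V]
    {H H' : AffineSubspace ℝ V} (hle : ¬ H ≤ H') {p : V} (hp : p ∈ H) {U : Set V}
    (hU : IsOpen U) (hpU : p ∈ U) : ∃ p' ∈ H, p' ∉ H' ∧ p' ∈ U := by
  by_cases hp' : p ∈ H'
  · obtain ⟨r, hr, hr'⟩ := SetLike.not_le_iff_exists.mp hle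
    have hcont : Continuous fun t : ℝ => lineMap p r t := lineMap_continuous
    have hev : ∀ᶠ t in 𝓝[>] (0 : ℝ), lineMap p r t ∈ U :=
      nhdsWithin_le_nhds (hcont.continuousAt.eventually_mem (hU.mem_nhds (by simpa using hpU)))
    obtain ⟨t, htU, ht⟩ := (hev.and self_mem_nhdsWithin).exists
    exact ⟨lineMap p r t, lineMap_mem t hp hr,
      fun h => hr' (right_mem_of_lineMap_mem (ne_of_gt ht) hp' h), htU⟩
  · exact ⟨p, hp, hp', hpU⟩

open AffineMap in
/-- A convex set containing two points of a line contains every point of the line in between. -/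
lemma Convex.lineMap_mem_of_le {V : Type*} [AddCommGroup V] [Module ℝ V] {K : Set V}
    (hK : Convex ℝ K) {p q : V} {a b c : ℝ} (ha : lineMap p q a ∈ K) (hb : lineMap p q b ∈ K)
    (hac : a ≤ c) (hcb : c ≤ b) : lineMap p q c ∈ K :=
  (hK.affine_preimage (lineMap p q : ℝ →ᵃ[ℝ] V)).ordConnected.out ha hb ⟨hac, hcb⟩

open AffineMap in
/-- The union of two convex sets which misses two points `p` and `q` cannot contain a
point of the line `pq` in each of its three parts cut out by `p` and `q`. -/
lemma Convex.false_of_lineMap_mem_union_of_notMem {V : Type*} [AddCommGroup V] [Module ℝ V]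
    {K L : Set V} (hK : Convex ℝ K) (hL : Convex ℝ L) {p q : V}
    (hp : p ∉ K ∪ L) (hq : q ∉ K ∪ L) {t : ℝ} (ht : 0 < t) (ht1 : t < 1)
    (ha : lineMap p q (-t) ∈ K ∪ L) (hb : lineMap p q t ∈ K ∪ L)
    (hd : lineMap p q (1 + t) ∈ K ∪ L) : False := by
  have key : ∀ {A B : Set V}, Convex ℝ A → Convex ℝ B → p ∉ A → q ∉ B →
      lineMap p q (-t) ∈ A → (lineMap p q t ∈ A ∨ lineMap p q t ∈ B) →
      (lineMap p q (1 + t) ∈ A ∨ lineMap p q (1 + t) ∈ B) → False := by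
    intro A B hA hB hpA hqB haA hb hd
    have hnot : ∀ s : ℝ, 0 < s → lineMap p q s ∉ A := fun s hs h =>
      hpA (by simpa using hA.lineMap_mem_of_le haA h (by linarith : -t ≤ 0) hs.le)
    have hbB := hb.resolve_left (hnot _ ht)
    have hdB := hd.resolve_left (hnot _ (by linarith))
    exact hqB (by simpa using hB.lineMap_mem_of_le hbB hdB ht1.le (by linarith : (1 : ℝ) ≤ 1 + t))
  simp only [Set.mem_union, not_or] at hp hq
  rcases ha with ha | ha
  · exact key hK hL hp.1 hq.2 ha hb hd
  · exact key hL hK hp.2 hq.1 ha hb.symm hd.symm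

/-- For the complement `S` of a union of two convex sets in `ℝ^d` and any
`0 ≤ k ≤ d`, `S` has at most one `k`-ordinary flat. -/
theorem ordinary_flat_of_two_convex_unique (d k : ℕ) (hk : k ≤ d)
    (K₁ K₂ : Set (EuclideanSpace ℝ (Fin d)))
    (hK₁ : Convex ℝ K₁) (hK₂ : Convex ℝ K₂)
    (J₁ J₂ : AffineSubspace ℝ (EuclideanSpace ℝ (Fin d)))
    (hJ₁ : IsOrdinaryFlat (K₁ ∪ K₂)ᶜ k J₁)
    (hJ₂ : IsOrdinaryFlat (K₁ ∪ K₂)ᶜ k J₂) :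
    J₁ = J₂ := by
  by_contra hne
  obtain ⟨hr₁, p₀, hp₀, -, U, hU, hp₀U, hSU⟩ := hJ₁
  obtain ⟨hr₂, q₀, hq₀, -, V, hV, hq₀V, hSV⟩ := hJ₂
  have hp₀J : p₀ ∈ J₁ := (hSU.subset ⟨hp₀, hp₀U⟩).1
  have hq₀J : q₀ ∈ J₂ := (hSV.subset ⟨hq₀, hq₀V⟩).1
  have hle₁ : ¬ J₁ ≤ J₂ := fun h => hne <| AffineSubspace.eq_of_direction_eq_of_nonempty_of_le
    (Submodule.eq_of_le_of_finrank_eq (AffineSubspace.direction_le h) (hr₁.trans hr₂.symm))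
    ⟨p₀, hp₀J⟩ h
  have hle₂ : ¬ J₂ ≤ J₁ := fun h => Ne.symm hne <| AffineSubspace.eq_of_direction_eq_of_nonempty_of_le
    (Submodule.eq_of_le_of_finrank_eq (AffineSubspace.direction_le h) (hr₂.trans hr₁.symm))
    ⟨q₀, hq₀J⟩ h
  obtain ⟨p, hpJ, hpJ', hpU⟩ := AffineSubspace.exists_mem_notMem_of_not_le hle₁ hp₀J hU hp₀U
  obtain ⟨q, hqJ, hqJ', hqV⟩ := AffineSubspace.exists_mem_notMem_of_not_le hle₂ hq₀J hV hq₀V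
  have hp : p ∉ K₁ ∪ K₂ := (hSU.superset ⟨hpJ, hpU⟩).1
  have hq : q ∉ K₁ ∪ K₂ := (hSV.superset ⟨hqJ, hqV⟩).1
  have hcont : Continuous fun t : ℝ => AffineMap.lineMap p q t := AffineMap.lineMap_continuous
  have hmemU : ∀ t : ℝ, t ≠ 0 → AffineMap.lineMap p q t ∈ U →
      AffineMap.lineMap p q t ∈ K₁ ∪ K₂ := fun t ht htU => by
    by_contra hS
    exact hqJ' (AffineSubspace.right_mem_of_lineMap_mem ht hpJ (hSU.subset ⟨hS, htU⟩).1)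
  have hmemV : ∀ t : ℝ, t ≠ 0 → AffineMap.lineMap p q (1 + t) ∈ V →
      AffineMap.lineMap p q (1 + t) ∈ K₁ ∪ K₂ := fun t ht htV => by
    by_contra hS
    have h := (hSV.subset ⟨hS, htV⟩).1
    rw [← AffineMap.lineMap_apply_one_sub, show 1 - (1 + t) = -t by ring] at h
    exact hpJ' (AffineSubspace.right_mem_of_lineMap_mem (neg_ne_zero.mpr ht) hqJ h)
  have h₁ : ∀ᶠ t : ℝ in nhds 0, AffineMap.lineMap p q (-t) ∈ U :=
    (hcont.comp continuous_neg).continuousAt.eventually_mem (hU.mem_nhds (by simpa using hpU))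
  have h₂ : ∀ᶠ t : ℝ in nhds 0, AffineMap.lineMap p q t ∈ U :=
    hcont.continuousAt.eventually_mem (hU.mem_nhds (by simpa using hpU))
  have h₃ : ∀ᶠ t : ℝ in nhds 0, AffineMap.lineMap p q (1 + t) ∈ V :=
    (hcont.comp (continuous_const_add 1)).continuousAt.eventually_mem
      (hV.mem_nhds (by simpa using hqV))
  have hsmall := nhdsWithin_le_nhds (s := Ioi 0)
    ((h₁.and (h₂.and h₃)).and (gt_mem_nhds (zero_lt_one' ℝ)))
  obtain ⟨t, ⟨⟨ha, hb, hd⟩, ht1⟩, ht⟩ :=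
    (Filter.Eventually.and hsmall self_mem_nhdsWithin).exists
  have ht0 : t ≠ 0 := ne_of_gt ht
  exact hK₁.false_of_lineMap_mem_union_of_notMem hK₂ hp hq ht ht1
    (hmemU _ (neg_ne_zero.mpr ht0) ha) (hmemU _ ht0 hb) (hmemV _ ht0 hd)
end

section
/- Let A, B ⊆ ℝ^d be convex sets with A ∩ B = ∅, and let z ∈ ℝ^d \ (A ∪ B). Then there exist convex sets Ã, B̃ ⊆ ℝ^d with A ⊆ Ã, B ⊆ B̃, Ã ∩ B̃ = ∅, and Ã ∪ B̃ = ℝ^d \ {z} if and only if A ∩ conv(B ∪ {z}) = ∅ and B ∩ conv(A ∪ {z}) = ∅, where conv denotes the convex hull. -/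
open Metric Set

/-- The join of two blunt convex cones is blunt if neither meets the negative of the other. -/
theorem ConvexCone.Blunt.sup {E : Type*} [AddCommGroup E] [Module ℝ E] {C D : ConvexCone ℝ E}
    (hC : C.Blunt) (hD : D.Blunt) (h : ∀ x ∈ C, -x ∉ D) : (C ⊔ D).Blunt := by
  let F : ConvexCone ℝ E :=
    { carrier := {x | x ∈ C ∨ x ∈ D ∨ ∃ c ∈ C, ∃ d ∈ D, x = c + d}
      smul_mem' := by
        rintro r hr x (hx | hx | ⟨c, hc, d, hd, rfl⟩)
        · exact Or.inl (C.smul_mem hr hx)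
        · exact Or.inr (Or.inl (D.smul_mem hr hx))
        · exact Or.inr (Or.inr ⟨_, C.smul_mem hr hc, _, D.smul_mem hr hd, smul_add _ _ _⟩)
      add_mem' := by
        rintro x (hx | hx | ⟨c, hc, d, hd, rfl⟩) y (hy | hy | ⟨c', hc', d', hd', rfl⟩)
        · exact Or.inl (C.add_mem hx hy)
        · exact Or.inr (Or.inr ⟨x, hx, y, hy, rfl⟩)
        · exact Or.inr (Or.inr ⟨x + c', C.add_mem hx hc', d', hd', by abel⟩)
        · exact Or.inr (Or.inr ⟨y, hy, x, hx, by abel⟩)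
        · exact Or.inr (Or.inl (D.add_mem hx hy))
        · exact Or.inr (Or.inr ⟨c', hc', x + d', D.add_mem hx hd', by abel⟩)
        · exact Or.inr (Or.inr ⟨c + y, C.add_mem hc hy, d, hd, by abel⟩)
        · exact Or.inr (Or.inr ⟨c, hc, d + y, D.add_mem hd hy, by abel⟩)
        · exact Or.inr (Or.inr
            ⟨c + c', C.add_mem hc hc', d + d', D.add_mem hd hd', by abel⟩) }
  have hF : F.Blunt := by
    rintro (h0 | h0 | ⟨c, hc, d, hd, h0⟩)
    · exact hC h0
    · exact hD h0
    · exact h c hc (by rwa [neg_eq_of_add_eq_zero_right h0.symm])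
  exact hF.anti (sup_le (fun x hx => Or.inl hx) (fun x hx => Or.inr (Or.inl hx)))

/-- The cone generated by a convex set avoiding the origin is blunt. -/
theorem ConvexCone.blunt_hull_of_convex {E : Type*} [AddCommGroup E] [Module ℝ E] {s : Set E}
    (hs : Convex ℝ s) (h0 : (0 : E) ∉ s) : (ConvexCone.hull ℝ s).Blunt := by
  intro h
  obtain ⟨r, hr, x, hx, hrx⟩ := (ConvexCone.mem_hull_of_convex hs).1 h
  rcases smul_eq_zero.1 hrx with h | rfl
  · exact hr.ne' h
  · exact h0 hx

/-- Every blunt convex cone extends to a blunt convex cone containing one of `x`, `-x` for each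
nonzero `x`. -/
theorem ConvexCone.Blunt.exists_total {E : Type*} [AddCommGroup E] [Module ℝ E]
    {C : ConvexCone ℝ E} (hC : C.Blunt) :
    ∃ D : ConvexCone ℝ E, C ≤ D ∧ D.Blunt ∧ ∀ x ≠ 0, x ∈ D ∨ -x ∈ D := by
  obtain ⟨M, hCM, hM⟩ := zorn_le_nonempty₀ {D : ConvexCone ℝ E | D.Blunt} (by
    intro c hc hchain y hy
    let U : ConvexCone ℝ E :=
      { carrier := {x | ∃ D ∈ c, x ∈ D}
        smul_mem' := by
          rintro r hr x ⟨D, hD, hx⟩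
          exact ⟨D, hD, D.smul_mem hr hx⟩
        add_mem' := by
          rintro x ⟨D, hD, hx⟩ y ⟨D', hD', hy⟩
          rcases hchain.total hD hD' with h | h
          · exact ⟨D', hD', D'.add_mem (h hx) hy⟩
          · exact ⟨D, hD, D.add_mem hx (h hy)⟩ }
    refine ⟨U, ?_, fun D hD x hx => ⟨D, hD, hx⟩⟩
    rintro ⟨D, hD, h0⟩
    exact hc hD h0) C hC
  refine ⟨M, hCM, hM.prop, fun x hx => or_iff_not_imp_right.2 fun hneg => ?_⟩
  have hblunt : (M ⊔ ConvexCone.hull ℝ {x}).Blunt := by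
    refine ConvexCone.Blunt.sup hM.prop
      (ConvexCone.blunt_hull_of_convex (convex_singleton x) (by simpa using hx.symm)) ?_
    intro y hy hyx
    obtain ⟨r, hr, w, rfl, hrw⟩ := (ConvexCone.mem_hull_of_convex (convex_singleton x)).1 hyx
    refine hneg ?_
    have := M.smul_mem (inv_pos.2 hr) hy
    rwa [← neg_neg y, ← hrw, smul_neg, inv_smul_smul₀ hr.ne'] at this
  exact hM.le_of_ge hblunt le_sup_left
    ((le_sup_right : ConvexCone.hull ℝ {x} ≤ _) (ConvexCone.subset_hull rfl))

/-- The preimage of a convex set under the point reflection `x ↦ z - x` is convex. -/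
theorem Convex.preimage_const_sub {E : Type*} [AddCommGroup E] [Module ℝ E] {s : Set E}
    (hs : Convex ℝ s) (z : E) : Convex ℝ {x | z - x ∈ s} := by
  have h : {x | z - x ∈ s} = -((fun x => z + x) ⁻¹' s) := by
    ext x
    simp [sub_eq_add_neg]
  exact h ▸ (hs.translate_preimage_right z).neg

/-- If `b - z` is a multiple of `a - z` by a factor in `[0, 1]`, then `b` lies in the convex hull
of `a` and `z`. -/
theorem mem_convexHull_union_singleton_of_smul_sub_eq {E : Type*} [AddCommGroup E] [Module ℝ E]
    {A : Set E} {a b z : E} (ha : a ∈ A) {r s : ℝ} (hr : 0 < r) (hrs : r ≤ s)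
    (h : r • (a - z) = s • (b - z)) : b ∈ convexHull ℝ (A ∪ {z}) := by
  have hs : 0 < s := hr.trans_le hrs
  have hb : b = z + (r / s) • (a - z) := by
    rw [div_eq_inv_mul, mul_smul, h, inv_smul_smul₀ hs.ne', add_sub_cancel]
  rw [hb]
  exact (convex_convexHull ℝ (A ∪ {z})).add_smul_sub_mem (subset_convexHull ℝ _ (Or.inr rfl))
    (subset_convexHull ℝ _ (Or.inl ha)) ⟨by positivity, (div_le_one hs).2 hrs⟩

/-- If the union of two convex sets is the complement of `z`, then the first does not meet the
join of `z` with any convex subset of the second. -/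
theorem inter_convexHull_union_singleton_eq_empty {E : Type*} [AddCommGroup E] [Module ℝ E]
    {A' B B' : Set E} {z : E} (hA' : Convex ℝ A') (hB' : Convex ℝ B') (hB : Convex ℝ B)
    (hBB' : B ⊆ B') (hunion : A' ∪ B' = {z}ᶜ) :
    A' ∩ convexHull ℝ (B ∪ {z}) = ∅ := by
  have hzA : z ∉ A' := fun h => (hunion.subset (Or.inl h)) rfl
  have hzB : z ∉ B' := fun h => (hunion.subset (Or.inr h)) rfl
  refine eq_empty_of_forall_notMem ?_
  rintro x ⟨hxA, hx⟩
  have hxz : x ≠ z := fun h => hzA (h ▸ hxA)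
  rcases B.eq_empty_or_nonempty with rfl | hne
  · simp [hxz] at hx
  rw [union_singleton, convexHull_insert hne, hB.convexHull_eq] at hx
  obtain ⟨w, rfl, b, hb, hseg⟩ := mem_convexJoin.1 hx
  rw [segment_eq_image'] at hseg
  obtain ⟨t, ⟨ht0, -⟩, rfl⟩ := hseg
  have ht : 0 < t := ht0.lt_of_ne (by rintro rfl; simp at hxz)
  have hy : w - t • (b - w) ∈ A' ∪ B' := by
    rw [hunion]
    intro h
    apply hxz
    have : t • (b - w) = 0 := by simpa using h
    simp [this]
  rcases hy with hy | hy
  · apply hzA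
    convert hA' hxA hy (by norm_num : (0 : ℝ) ≤ 1 / 2) (by norm_num : (0 : ℝ) ≤ 1 / 2)
      (by norm_num) using 1
    module
  · apply hzB
    convert hB' (hBB' hb) hy (by positivity : 0 ≤ t / (1 + t)) (by positivity : 0 ≤ 1 / (1 + t))
      (by field_simp; ring) using 1
    match_scalars <;> field_simp <;> ring

/-- Disjoint convex sets `A, B ⊆ ℝ^d` extend to disjoint convex sets `Ã, B̃` with
`Ã ∪ B̃ = ℝ^d \ {z}` if and only if `A ∩ conv(B ∪ {z}) = ∅` and
`B ∩ conv(A ∪ {z}) = ∅`. -/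
theorem extend_disjoint_convex_iff (d : ℕ)
    (A B : Set (EuclideanSpace ℝ (Fin d)))
    (hA : Convex ℝ A) (hB : Convex ℝ B) (hAB : A ∩ B = ∅)
    (z : EuclideanSpace ℝ (Fin d)) (hz : z ∉ A ∪ B) :
    (∃ A' B' : Set (EuclideanSpace ℝ (Fin d)),
      Convex ℝ A' ∧ Convex ℝ B' ∧ A ⊆ A' ∧ B ⊆ B' ∧ A' ∩ B' = ∅ ∧
      A' ∪ B' = {z}ᶜ) ↔
    (A ∩ convexHull ℝ (B ∪ {z}) = ∅ ∧ B ∩ convexHull ℝ (A ∪ {z}) = ∅) := by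
  constructor
  · rintro ⟨A', B', hA', hB', hAA', hBB', -, hunion⟩
    exact ⟨subset_empty_iff.1 ((inter_subset_inter_left _ hAA').trans
        (inter_convexHull_union_singleton_eq_empty hA' hB' hB hBB' hunion).subset),
      subset_empty_iff.1 ((inter_subset_inter_left _ hBB').trans
        (inter_convexHull_union_singleton_eq_empty hB' hA' hA hAA'
          (by rwa [union_comm])).subset)⟩
  · rintro ⟨h₁, h₂⟩
    have hA₀ : Convex ℝ {x | z + x ∈ A} := hA.translate_preimage_right z
    have hB₀ : Convex ℝ {x | z - x ∈ B} := hB.preimage_const_sub z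
    have hblunt : (ConvexCone.hull ℝ {x | z + x ∈ A} ⊔
        ConvexCone.hull ℝ {x | z - x ∈ B}).Blunt := by
      refine ConvexCone.Blunt.sup
        (ConvexCone.blunt_hull_of_convex hA₀ fun h => hz (Or.inl (by simpa using h)))
        (ConvexCone.blunt_hull_of_convex hB₀ fun h => hz (Or.inr (by simpa using h))) ?_
      intro x hx hx'
      obtain ⟨r, hr, a, ha, rfl⟩ := (ConvexCone.mem_hull_of_convex hA₀).1 hx
      obtain ⟨s, hs, b, hb, hab⟩ := (ConvexCone.mem_hull_of_convex hB₀).1 hx'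
      have hab' : s • b = -(r • a) := hab
      have key : r • ((z + a) - z) = s • ((z - b) - z) := by
        simp [hab']
      rcases le_total r s with hrs | hsr
      · exact h₂.subset ⟨hb, mem_convexHull_union_singleton_of_smul_sub_eq ha hr hrs key⟩
      · exact h₁.subset ⟨ha, mem_convexHull_union_singleton_of_smul_sub_eq hb hs hsr key.symm⟩
    obtain ⟨M, hle, hM, htotal⟩ := hblunt.exists_total
    refine ⟨{x | x - z ∈ M}, {x | z - x ∈ M}, ?_, ?_, ?_, ?_, ?_, ?_⟩
    · simpa [preimage, sub_eq_add_neg] using M.convex.translate_preimage_left (-z)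
    · exact M.convex.preimage_const_sub z
    · intro x hx
      exact hle ((le_sup_left : ConvexCone.hull ℝ {x | z + x ∈ A} ≤ _)
        (ConvexCone.subset_hull (by simpa using hx)))
    · intro x hx
      exact hle ((le_sup_right : ConvexCone.hull ℝ {x | z - x ∈ B} ≤ _)
        (ConvexCone.subset_hull (by simpa using hx)))
    · refine eq_empty_of_forall_notMem fun x hx => hM ?_
      simpa using M.add_mem hx.1 hx.2
    · ext x
      constructor
      · rintro (h | h) rfl <;> exact hM (by simpa using h)
      · intro hx
        simpa using htotal (x - z) (sub_ne_zero.2 hx)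
end
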